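/- Let K = u/v be shift-reduced with K ≠ 1, and set α₁ = deg(u), α₂ = deg(v), β = deg(v − u). Then dim_F(W_K) ≤ max{α₁, α₂} − ⟦β ≤ α₁ − 1⟧, where ⟦β ≤ α₁ − 1⟧ equals 1 if β ≤ α₁ − 1 and 0 otherwise. Consequently, every polynomial in F[y] is congruent modulo the image of φ_K to an F-linear combination of at most max{α₁, α₂} − ⟦β ≤ α₁ − 1⟧ fixed monomials. -/

import Mathlib

open Polynomial

noncomputable def pshift (F : Type*) [Field F] (i : ℤ) :
    Polynomial F →ₐ[F] Polynomial F :=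
  aeval (X + C (i : F))

noncomputable def rshift (F : Type*) [Field F] (i : ℤ) : RatFunc F → RatFunc F :=
  fun f => RatFunc.mk (pshift F i f.num) (pshift F i f.denom)

def shiftFree {F : Type*} [Field F] (p : Polynomial F) : Prop :=
  p ≠ 0 ∧ ∀ i : ℤ, i ≠ 0 → IsCoprime p (pshift F i p)

def shiftReducedPair {F : Type*} [Field F] (u v : Polynomial F) : Prop :=
  u ≠ 0 ∧ v ≠ 0 ∧ IsCoprime u v ∧ ∀ i : ℤ, IsCoprime u (pshift F i v)

def stronglyPrime {F : Type*} [Field F] (p u v : Polynomial F) : Prop :=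
  p ≠ 0 ∧ ∀ i : ℕ, IsCoprime p (pshift F (-(i : ℤ)) u) ∧ IsCoprime p (pshift F (i : ℤ) v)

noncomputable def phiK {F : Type*} [Field F] (u v : Polynomial F) :
    Polynomial F → Polynomial F :=
  fun p => u * pshift F 1 p - v * p

noncomputable def WK (F : Type*) [Field F] (u v : Polynomial F) :
    Submodule F (Polynomial F) :=
  Submodule.span F {q : Polynomial F | ∃ ℓ : ℕ, q = X ^ ℓ ∧
    ∀ w : Polynomial F, w ∈ Set.range (phiK u v) → w ≠ 0 → ℓ ≠ w.natDegree}

def VK {F : Type*} [Field F] (K : RatFunc F) : Set (RatFunc F) :=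
  {g | ∃ r : RatFunc F, g = K * rshift F 1 r - r}

def residualForm {F : Type*} [Field F] (u v : Polynomial F) (r : RatFunc F) : Prop :=
  ∃ a b q : Polynomial F, a.degree < b.degree ∧ shiftFree b ∧ stronglyPrime b u v ∧
    q ∈ WK F u v ∧ r = RatFunc.mk a b + RatFunc.mk q v

theorem pshift_eq_taylor {F : Type*} [Field F] (i : ℤ) (p : F[X]) :
    pshift F i p = taylor (i : F) p := by
  simp [pshift, taylor_apply, comp, aeval_def]

theorem pshift_pshift {F : Type*} [Field F] (i j : ℤ) (p : F[X]) :
    pshift F i (pshift F j p) = pshift F (i + j) p := by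
  simp only [pshift_eq_taylor, taylor_taylor, Int.cast_add]

theorem pshift_zero {F : Type*} [Field F] (p : F[X]) : pshift F 0 p = p := by
  simp [pshift_eq_taylor]

theorem degree_pshift {F : Type*} [Field F] (i : ℤ) (p : F[X]) :
    (pshift F i p).degree = p.degree := by
  rw [pshift_eq_taylor, degree_taylor]

theorem natDegree_pshift {F : Type*} [Field F] (i : ℤ) (p : F[X]) :
    (pshift F i p).natDegree = p.natDegree := by
  rw [pshift_eq_taylor, natDegree_taylor]

theorem leadingCoeff_pshift {F : Type*} [Field F] (i : ℤ) (p : F[X]) :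
    (pshift F i p).leadingCoeff = p.leadingCoeff := by
  rw [pshift_eq_taylor, leadingCoeff_taylor]

theorem isCoprime_pshift_left {F : Type*} [Field F] {u v : F[X]}
    (h : ∀ i : ℤ, IsCoprime u (pshift F i v)) (i : ℤ) : IsCoprime (pshift F i u) v := by
  have := (h (-i)).map (pshift F i).toRingHom
  simpa [pshift_pshift, pshift_zero] using this

theorem pshift_mul_ne {F : Type*} [Field F] {u v : F[X]}
    (h : ∀ i : ℤ, IsCoprime u (pshift F i v)) (hu : 0 < u.natDegree) (p : F[X]) (hp : p ≠ 0)
    (i : ℤ) : pshift F i u * pshift F 1 p ≠ v * p := by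
  induction hd : p.natDegree using Nat.strong_induction_on generalizing p i with
  | _ d ih =>
    intro he
    obtain ⟨q, rfl⟩ := (isCoprime_pshift_left h i).dvd_of_dvd_mul_left (Dvd.intro _ he)
    have hq : q ≠ 0 := right_ne_zero_of_mul hp
    have hs : pshift F i u ≠ 0 := left_ne_zero_of_mul hp
    rw [natDegree_mul hs hq, natDegree_pshift] at hd
    refine ih q.natDegree (by omega) q hq (1 + i) rfl (mul_left_cancel₀ hs ?_)
    rw [map_mul, pshift_pshift] at he
    linear_combination he

theorem phiK_ne_zero {F : Type*} [Field F] {u v : F[X]} (hsr : shiftReducedPair u v)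
    (huv : u ≠ v) {p : F[X]} (hp : p ≠ 0) : phiK u v p ≠ 0 := by
  obtain ⟨hu, hv, -, h⟩ := hsr
  intro h0
  have he : u * pshift F 1 p = v * p := sub_eq_zero.1 h0
  rcases Nat.eq_zero_or_pos u.natDegree with hd | hd
  · have hs : pshift F 1 p ≠ 0 := by
      rw [← degree_ne_bot, degree_pshift]; exact degree_ne_bot.2 hp
    have hn := congrArg natDegree he
    rw [natDegree_mul hu hs, natDegree_mul hv hp, natDegree_pshift] at hn
    have hl := congrArg leadingCoeff he
    rw [leadingCoeff_mul, leadingCoeff_mul, leadingCoeff_pshift] at hl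
    have hl := mul_right_cancel₀ (leadingCoeff_ne_zero.2 hp) hl
    apply huv
    rw [leadingCoeff, leadingCoeff, show v.natDegree = 0 by omega, hd] at hl
    rw [eq_C_of_natDegree_eq_zero hd, hl, ← eq_C_of_natDegree_eq_zero (by omega)]
  · exact pshift_mul_ne h hd p hp 0 (by rwa [pshift_zero])

noncomputable def phiKLinear {F : Type*} [Field F] (u v : F[X]) : F[X] →ₗ[F] F[X] :=
  LinearMap.mulLeft F u ∘ₗ (pshift F 1).toLinearMap - LinearMap.mulLeft F v

theorem phiKLinear_apply {F : Type*} [Field F] (u v p : F[X]) :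
    phiKLinear u v p = phiK u v p := rfl

theorem natDegree_phiK_le {F : Type*} [Field F] (u v p : F[X]) :
    (phiK u v p).natDegree ≤ max u.natDegree v.natDegree + p.natDegree := by
  refine (natDegree_sub_le _ _).trans (max_le ?_ ?_)
  · refine natDegree_mul_le.trans ?_
    rw [natDegree_pshift]
    gcongr
    exact le_max_left _ _
  · refine natDegree_mul_le.trans ?_
    gcongr
    exact le_max_right _ _

theorem natDegree_phiK_lt {F : Type*} [Field F] {u v p : F[X]} (hp : p ≠ 0)
    (h : (v - u).natDegree < u.natDegree) :
    (phiK u v p).natDegree < u.natDegree + p.natDegree := by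
  have hu : u ≠ 0 := by rintro rfl; simp at h
  have hs : (pshift F 1 p - p).degree < p.degree := by
    have := degree_sub_lt_left (degree_pshift 1 p)
      (by rw [← degree_ne_bot, degree_pshift]; exact degree_ne_bot.2 hp) (leadingCoeff_pshift 1 p)
    rwa [degree_pshift] at this
  have hd : (v - u).degree < u.degree := degree_lt_degree h
  have he : phiK u v p = u * (pshift F 1 p - p) - (v - u) * p := by
    rw [phiK]; ring
  have hlt : (phiK u v p).degree < (u * p).degree := by
    rw [he]
    refine (degree_sub_le _ _).trans_lt (max_lt ?_ ?_)
    · rw [degree_mul, degree_mul]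
      exact WithBot.add_lt_add_left (degree_ne_bot.2 hu) hs
    · rw [degree_mul, degree_mul]
      exact WithBot.add_lt_add_right (degree_ne_bot.2 hp) hd
  rw [← natDegree_mul hu hp]
  by_cases h0 : phiK u v p = 0
  · rw [h0, natDegree_zero, natDegree_mul hu hp]; omega
  · exact natDegree_lt_natDegree h0 hlt

/-- The exponents that are not the degree of a nonzero polynomial in the range of `f`. -/
def missingDegrees {F : Type*} [Field F] (f : F[X] → F[X]) : Set ℕ :=
  {n | ∀ w ∈ Set.range f, w ≠ 0 → n ≠ w.natDegree}

/-- An injective linear map raising degrees by at most `N` misses at most `N` degrees. -/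
theorem encard_missingDegrees_le {F : Type*} [Field F] (f : F[X] →ₗ[F] F[X]) (N : ℕ)
    (hf : ∀ p ≠ 0, f p ≠ 0) (hN : ∀ p ≠ 0, (f p).natDegree ≤ N + p.natDegree) :
    (missingDegrees f).encard ≤ N := by
  classical
  by_contra! hlt
  obtain ⟨s, hs, hc⟩ := Set.exists_subset_encard_eq (Order.add_one_le_of_lt hlt)
  have hfin : s.Finite := Set.finite_of_encard_eq_coe (k := N + 1) (by simpa using hc)
  obtain ⟨m, hm⟩ := hfin.bddAbove
  set T := Finset.range (m + 1 + N) \ hfin.toFinset with hT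
  have hcard : hfin.toFinset.card = N + 1 := by
    rw [hfin.encard_eq_coe_toFinset_card] at hc
    exact_mod_cast hc
  have hsub : hfin.toFinset ⊆ Finset.range (m + 1 + N) := by
    intro x hx
    have := hm (hfin.mem_toFinset.1 hx)
    simp only [Finset.mem_range]
    omega
  have hTc : T.card + (N + 1) = m + 1 + N := by
    rw [← hcard, hT, Finset.card_sdiff_add_card_eq_card hsub, Finset.card_range]
  let g : degreeLT F (m + 1) →ₗ[F] (T → F) :=
    (LinearMap.pi fun t : T => lcoeff F (t : ℕ)) ∘ₗ f ∘ₗ (degreeLT F (m + 1)).subtype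
  have hg : Function.Injective g := by
    rw [← LinearMap.ker_eq_bot, LinearMap.ker_eq_bot']
    rintro ⟨p, hp⟩ h0
    by_contra hne
    have hp0 : p ≠ 0 := fun h => hne (Subtype.ext h)
    have hpm : p.natDegree < m + 1 := (natDegree_lt_iff_degree_lt hp0).2 (mem_degreeLT.1 hp)
    have hmem : (f p).natDegree ∈ T := by
      have := hN p hp0
      rw [hT, Finset.mem_sdiff, Finset.mem_range, hfin.mem_toFinset]
      exact ⟨by omega, fun h => hs h _ ⟨p, rfl⟩ (hf p hp0) rfl⟩
    exact leadingCoeff_ne_zero.2 (hf p hp0) (congrFun h0 ⟨_, hmem⟩)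
  have := LinearMap.finrank_le_finrank_of_injective hg
  rw [(degreeLTEquiv F (m + 1)).finrank_eq, Module.finrank_fin_fun,
    Module.finrank_fintype_fun_eq_card, Fintype.card_coe] at this
  omega

theorem exists_sub_mem_span_missingDegrees {F : Type*} [Field F] (f : F[X] →ₗ[F] F[X]) (p : F[X]) :
    ∃ w ∈ Set.range f,
      p - w ∈ Submodule.span F ((fun i => (X : F[X]) ^ i) '' missingDegrees f) := by
  induction hd : p.degree using WellFoundedLT.induction generalizing p with
  | _ d ih =>
    subst hd
    by_cases hp : p = 0
    · exact ⟨0, ⟨0, map_zero f⟩, by simp [hp]⟩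
    by_cases hm : p.natDegree ∈ missingDegrees f
    · obtain ⟨w, hw, hr⟩ := ih p.eraseLead.degree (degree_eraseLead_lt hp) _ rfl
      refine ⟨w, hw, ?_⟩
      have he : p - w = (p.eraseLead - w) + p.leadingCoeff • X ^ p.natDegree := by
        rw [smul_eq_C_mul]
        linear_combination -p.eraseLead_add_C_mul_X_pow
      rw [he]
      exact add_mem hr (Submodule.smul_mem _ _ (Submodule.subset_span ⟨_, hm, rfl⟩))
    · simp only [missingDegrees, Set.mem_ofPred_eq, not_forall, not_not] at hm
      obtain ⟨_, ⟨q, rfl⟩, h0, he⟩ := hm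
      have hl := leadingCoeff_ne_zero.2 h0
      set c := p.leadingCoeff / (f q).leadingCoeff with hc
      have hc0 : c ≠ 0 := div_ne_zero (leadingCoeff_ne_zero.2 hp) hl
      have hlt : (p - f (c • q)).degree < p.degree := by
        rw [map_smul]
        refine degree_sub_lt_left ?_ hp ?_
        · rw [degree_smul_of_smul_regular _ (IsSMulRegular.of_ne_zero hc0),
            degree_eq_natDegree hp, degree_eq_natDegree h0, he]
        · rw [smul_eq_C_mul, leadingCoeff_mul, leadingCoeff_C, hc, div_mul_cancel₀ _ hl]
      obtain ⟨_, ⟨r, rfl⟩, hr⟩ := ih _ hlt _ rfl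
      exact ⟨_, ⟨c • q + r, rfl⟩, by rwa [map_add, ← sub_sub]⟩

theorem encard_missingDegrees_phiK_le {F : Type*} [Field F] {u v : F[X]}
    (hsr : shiftReducedPair u v) (huv : u ≠ v) :
    (missingDegrees (phiK u v)).encard ≤ (max u.natDegree v.natDegree -
      (if ((v - u).natDegree : ℤ) ≤ (u.natDegree : ℤ) - 1 then 1 else 0) : ℕ) := by
  refine encard_missingDegrees_le (phiKLinear u v) _ (fun p hp => phiK_ne_zero hsr huv hp) ?_
  intro p hp
  rw [phiKLinear_apply]
  split_ifs with h
  · have := natDegree_phiK_lt (u := u) (v := v) hp (by omega)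
    omega
  · simpa using natDegree_phiK_le u v p

theorem WK_eq_span_missingDegrees {F : Type*} [Field F] (u v : F[X]) :
    WK F u v = Submodule.span F ((fun i => (X : F[X]) ^ i) '' missingDegrees (phiK u v)) := by
  rw [WK]
  congr 1
  ext q
  exact ⟨fun ⟨l, hq, hl⟩ => ⟨l, hl, hq.symm⟩, fun ⟨l, hl, hq⟩ => ⟨l, hq.symm, hl⟩⟩

/-- dim W_K ≤ max{α₁,α₂} − ⟦β ≤ α₁−1⟧, and every polynomial reduces modulo
im(φ_K) to a linear combination of that many fixed monomials. -/
theorem stmt11 {F : Type*} [Field F] [CharZero F] (u v : Polynomial F)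
    (hsr : shiftReducedPair u v) (hK1 : RatFunc.mk u v ≠ 1) :
    Module.finrank F (WK F u v) ≤
      max u.natDegree v.natDegree -
        (if ((v - u).natDegree : ℤ) ≤ (u.natDegree : ℤ) - 1 then 1 else 0) ∧
    ∃ P : Finset ℕ,
      P.card ≤ max u.natDegree v.natDegree -
        (if ((v - u).natDegree : ℤ) ≤ (u.natDegree : ℤ) - 1 then 1 else 0) ∧
      ∀ p : Polynomial F, ∃ w ∈ Set.range (phiK u v),
        p - w ∈ Submodule.span F ((fun i => (X : Polynomial F) ^ i) '' ↑P) := by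
  classical
  have huv : u ≠ v := by
    rintro rfl
    exact hK1 (by rw [RatFunc.mk_eq_div, div_self (RatFunc.algebraMap_ne_zero hsr.1)])
  have hle := encard_missingDegrees_phiK_le hsr huv
  have hfin := Set.finite_of_encard_le_coe hle
  rw [hfin.encard_eq_coe_toFinset_card, Nat.cast_le] at hle
  refine ⟨?_, hfin.toFinset, hle, fun p => ?_⟩
  · rw [WK_eq_span_missingDegrees, ← hfin.coe_toFinset, ← Finset.coe_image]
    exact (finrank_span_finset_le_card _).trans (Finset.card_image_le.trans hle)
  · rw [hfin.coe_toFinset]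
    exact exists_sub_mem_span_missingDegrees (phiKLinear u v) p
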